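/- A nonempty set $E\subsetneq\mathbb{R}^n$ is weakly porous if and only if there exists $\alpha>0$ such that $\operatorname{dist}(\cdot,E)^{-\alpha}$ is an $A_1$ weight on $\mathbb{R}^n$. -/

import Mathlib

open MeasureTheory Metric Set

noncomputable section

/-- An axis-parallel half-open cube in `ℝⁿ`, given by its lower corner and side length. -/
structure Cube (n : ℕ) where
  a : EuclideanSpace ℝ (Fin n)
  l : ℝ
  pos : 0 < l

/-- The set of points of a cube. -/
def Cube.set {n : ℕ} (P : Cube n) : Set (EuclideanSpace ℝ (Fin n)) :=
  {x | ∀ i, P.a i ≤ x i ∧ x i < P.a i + P.l}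

/-- A weight: locally integrable and a.e. positive. -/
def IsWeight {n : ℕ} (w : EuclideanSpace ℝ (Fin n) → ℝ) : Prop :=
  LocallyIntegrable w volume ∧ ∀ᵐ x ∂(volume : Measure (EuclideanSpace ℝ (Fin n))), 0 < w x

/-- The `A₁` inequality with constant `C`, over all axis-parallel cubes. -/
def A1With {n : ℕ} (w : EuclideanSpace ℝ (Fin n) → ℝ) (C : ℝ) : Prop :=
  ∀ P : Cube n, (⨍ x in P.set, w x) ≤ C * essInf w (volume.restrict P.set)

/-- Membership in the Muckenhoupt class `A₁`. -/
def MemA1 {n : ℕ} (w : EuclideanSpace ℝ (Fin n) → ℝ) : Prop :=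
  IsWeight w ∧ ∃ C : ℝ, A1With w C

/-- The `A_p` inequality with constant `C`, over all axis-parallel cubes. -/
def ApWith {n : ℕ} (w : EuclideanSpace ℝ (Fin n) → ℝ) (p C : ℝ) : Prop :=
  ∀ P : Cube n,
    (⨍ x in P.set, w x) * (⨍ x in P.set, w x ^ (1 / (1 - p))) ^ (p - 1) ≤ C

/-- Membership in the Muckenhoupt class `A_p`. -/
def MemAp {n : ℕ} (w : EuclideanSpace ℝ (Fin n) → ℝ) (p : ℝ) : Prop :=
  IsWeight w ∧ ∃ C : ℝ, ApWith w p C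

/-- `Q` is a dyadic subcube of `P`. -/
def IsDyadicSubcube {n : ℕ} (P Q : Cube n) : Prop :=
  ∃ (j : ℕ) (k : Fin n → ℕ), (∀ i, k i < 2 ^ j) ∧
    Q.l = P.l / 2 ^ j ∧ ∀ i, Q.a i = P.a i + P.l * k i / 2 ^ j

/-- A cube is `E`-free if it does not meet `E`. -/
def EFree {n : ℕ} (E : Set (EuclideanSpace ℝ (Fin n))) (Q : Cube n) : Prop :=
  Q.set ∩ E = ∅

/-- The measure `|𝓜(P)|` of a largest `E`-free dyadic subcube of `P`
(`0` if there is none). -/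
def maxFree {n : ℕ} (E : Set (EuclideanSpace ℝ (Fin n))) (P : Cube n) : ℝ :=
  sSup {v : ℝ | ∃ Q : Cube n, IsDyadicSubcube P Q ∧ EFree E Q ∧ v = (volume Q.set).toReal}

/-- Weak porosity with constants `c`, `δ`. -/
def WeaklyPorousWith {n : ℕ} (E : Set (EuclideanSpace ℝ (Fin n))) (c δ : ℝ) : Prop :=
  ∀ P : Cube n, ∃ (N : ℕ) (Q : Fin N → Cube n),
    (∀ k, IsDyadicSubcube P (Q k) ∧ EFree E (Q k)) ∧
    (∀ k m, k ≠ m → Disjoint (Q k).set (Q m).set) ∧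
    (∀ k, δ * maxFree E P ≤ (volume (Q k).set).toReal) ∧
    c * (volume P.set).toReal ≤ ∑ k, (volume (Q k).set).toReal

/-- A set is weakly porous if it is weakly porous with some constants `0 < c, δ < 1`. -/
def WeaklyPorous {n : ℕ} (E : Set (EuclideanSpace ℝ (Fin n))) : Prop :=
  ∃ c δ : ℝ, 0 < c ∧ c < 1 ∧ 0 < δ ∧ δ < 1 ∧ WeaklyPorousWith E c δ

/-- Porosity. -/
def Porous {n : ℕ} (E : Set (EuclideanSpace ℝ (Fin n))) : Prop :=
  ∃ c : ℝ, 0 < c ∧ ∀ (x : EuclideanSpace ℝ (Fin n)) (r : ℝ), 0 < r →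
    ∃ y : EuclideanSpace ℝ (Fin n), ball y (c * r) ⊆ ball x r \ E

/-- The distance weight `dist(·,E)^{-α}`. -/
def distw {n : ℕ} (E : Set (EuclideanSpace ℝ (Fin n))) (α : ℝ)
    (x : EuclideanSpace ℝ (Fin n)) : ℝ :=
  infDist x E ^ (-α)

/-- `h_E(B(x,R))`: the supremum of radii `t` of balls contained in `B(x,R) \ E`. -/
def hFree {n : ℕ} (E : Set (EuclideanSpace ℝ (Fin n))) (x : EuclideanSpace ℝ (Fin n))
    (R : ℝ) : ℝ :=
  sSup {t : ℝ | ∃ y ∈ ball x R, ball y t ⊆ ball x R \ E}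

/-- The set of admissible exponents in the definition of the Muckenhoupt exponent. -/
def MuckSet {n : ℕ} (E : Set (EuclideanSpace ℝ (Fin n))) : Set ℝ :=
  {α : ℝ | ∃ C : ℝ, ∀ x ∈ E, ∀ R r : ℝ, 0 < r → r < hFree E x R → hFree E x R ≤ R →
    (volume (thickening r E ∩ ball x R)).toReal ≤
      C * (hFree E x R / r) ^ (-α) * (volume (ball x R)).toReal}

open scoped Classical in
/-- The Muckenhoupt exponent of `E`. -/
def MuckExp {n : ℕ} (E : Set (EuclideanSpace ℝ (Fin n))) : ℝ :=
  if ∀ x ∈ E, ∀ R : ℝ, 0 < R → 0 < hFree E x R then sSup (MuckSet E) else 0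

end

namespace Cube

variable {n : ℕ}

lemma ext_of_corner {P Q : Cube n} (ha : ∀ i, P.a i = Q.a i) (hl : P.l = Q.l) : P = Q := by
  cases P
  cases Q
  simp only [mk.injEq]
  exact ⟨by ext i; exact ha i, hl⟩

lemma set_eq_preimage (P : Cube n) :
    P.set = WithLp.ofLp ⁻¹'
      (Set.univ.pi fun i => Ico (P.a i) (P.a i + P.l)) := by
  ext x
  simp [Cube.set]

lemma measurableSet_set (P : Cube n) : MeasurableSet P.set := by
  rw [set_eq_preimage]
  exact (PiLp.volume_preserving_ofLp (Fin n)).measurable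
    (MeasurableSet.univ_pi fun i => measurableSet_Ico)

lemma volume_set (P : Cube n) : volume P.set = ENNReal.ofReal (P.l ^ n) := by
  rw [set_eq_preimage, (PiLp.volume_preserving_ofLp (Fin n)).measure_preimage
      (MeasurableSet.univ_pi fun i => measurableSet_Ico).nullMeasurableSet, Real.volume_pi_Ico]
  simp [ENNReal.ofReal_pow P.pos.le]

lemma volume_toReal (P : Cube n) : (volume P.set).toReal = P.l ^ n := by
  rw [volume_set, ENNReal.toReal_ofReal (pow_nonneg P.pos.le n)]

lemma volume_real (P : Cube n) : volume.real P.set = P.l ^ n := P.volume_toReal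

lemma volume_ne_top (P : Cube n) : volume P.set ≠ ⊤ := by
  rw [volume_set]; exact ENNReal.ofReal_ne_top

lemma volume_real_pos (P : Cube n) : 0 < volume.real P.set := by
  rw [volume_real]; exact pow_pos P.pos n

lemma dist_le (P : Cube n) {x y : EuclideanSpace ℝ (Fin n)} (hx : x ∈ P.set) (hy : y ∈ P.set) :
    dist x y ≤ √n * P.l := by
  rw [EuclideanSpace.dist_eq]
  apply Real.sqrt_le_iff.2 ⟨mul_nonneg (Real.sqrt_nonneg _) P.pos.le, ?_⟩
  calc ∑ i, dist (x i) (y i) ^ 2 ≤ ∑ _i : Fin n, P.l ^ 2 := by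
        gcongr with i
        rw [Real.dist_eq, abs_le]
        constructor <;> linarith [hx i, hy i, (hx i).1, (hx i).2, (hy i).1, (hy i).2]
    _ = (√n * P.l) ^ 2 := by
        rw [mul_pow, Real.sq_sqrt (Nat.cast_nonneg n)]; simp

lemma isBounded_set (P : Cube n) : Bornology.IsBounded P.set :=
  Metric.isBounded_iff.2 ⟨_, fun _ hx _ hy => P.dist_le hx hy⟩

/-- The cube obtained by shrinking `P` to half its side length about its centre. -/
noncomputable def middle (P : Cube n) : Cube n where
  a := WithLp.toLp 2 fun i => P.a i + P.l / 4
  l := P.l / 2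
  pos := half_pos P.pos

lemma middle_subset (P : Cube n) : P.middle.set ⊆ P.set := by
  intro x hx i
  have h := hx i
  have := P.pos
  simp only [middle] at h
  constructor <;> linarith [h.1, h.2]

lemma nonempty_set (P : Cube n) : P.set.Nonempty :=
  ⟨P.a, fun _ => ⟨le_rfl, lt_add_of_pos_right _ P.pos⟩⟩

/-- The cube of side `P.l / N` at position `k` in the subdivision of `P` into `N ^ n` cubes. -/
noncomputable def sub (P : Cube n) {N : ℕ} (hN : 0 < N) (k : Fin n → Fin N) : Cube n where
  a := WithLp.toLp 2 fun i => P.a i + P.l * (k i : ℕ) / N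
  l := P.l / N
  pos := div_pos P.pos (Nat.cast_pos.2 hN)

lemma mem_sub (P : Cube n) {N : ℕ} (hN : 0 < N) (k : Fin n → Fin N)
    {x : EuclideanSpace ℝ (Fin n)} :
    x ∈ (P.sub hN k).set ↔
      ∀ i, (k i : ℝ) ≤ (x i - P.a i) * N / P.l ∧ (x i - P.a i) * N / P.l < (k i : ℝ) + 1 := by
  have hl := P.pos
  have hN' : (0 : ℝ) < N := Nat.cast_pos.2 hN
  refine forall_congr' fun i => and_congr ?_ ?_
  · simp only [sub]
    rw [le_div_iff₀ hl, ← le_sub_iff_add_le', div_le_iff₀ hN', mul_comm P.l]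
  · simp only [sub]
    rw [div_lt_iff₀ hl, add_assoc, ← sub_lt_iff_lt_add', ← add_div, lt_div_iff₀ hN']
    ring_nf

lemma sub_subset (P : Cube n) {N : ℕ} (hN : 0 < N) (k : Fin n → Fin N) :
    (P.sub hN k).set ⊆ P.set := by
  intro x hx i
  have h := (P.mem_sub hN k).1 hx i
  have hl := P.pos
  have hN' : (0 : ℝ) < N := Nat.cast_pos.2 hN
  have hk : ((k i : ℕ) : ℝ) + 1 ≤ N := by exact_mod_cast (k i).2
  have h0 : (0 : ℝ) ≤ (k i : ℕ) := Nat.cast_nonneg _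
  have h1 := h0.trans h.1
  have h2 := h.2.trans_le hk
  rw [le_div_iff₀ hl, zero_mul] at h1
  rw [div_lt_iff₀ hl] at h2
  have h3 := nonneg_of_mul_nonneg_left h1 hN'
  have h4 : x i - P.a i < P.l := by
    by_contra! h
    nlinarith
  constructor <;> linarith

lemma exists_mem_sub (P : Cube n) {N : ℕ} (hN : 0 < N) {x : EuclideanSpace ℝ (Fin n)}
    (hx : x ∈ P.set) : ∃ k : Fin n → Fin N, x ∈ (P.sub hN k).set := by
  have hl := P.pos
  have hN' : (0 : ℝ) < N := Nat.cast_pos.2 hN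
  have h0 : ∀ i, 0 ≤ (x i - P.a i) * N / P.l := fun i => by
    have := (hx i).1
    have : 0 ≤ x i - P.a i := by linarith
    positivity
  have h1 : ∀ i, (x i - P.a i) * N / P.l < N := fun i => by
    rw [div_lt_iff₀ hl, mul_comm (N : ℝ)]
    exact mul_lt_mul_of_pos_right (by linarith [(hx i).2]) hN'
  refine ⟨fun i => ⟨⌊(x i - P.a i) * N / P.l⌋₊, (Nat.floor_lt (h0 i)).2 (h1 i)⟩, ?_⟩
  rw [mem_sub]
  exact fun i => ⟨Nat.floor_le (h0 i), Nat.lt_floor_add_one _⟩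

lemma iUnion_sub (P : Cube n) {N : ℕ} (hN : 0 < N) : ⋃ k, (P.sub hN k).set = P.set :=
  Subset.antisymm (iUnion_subset fun k => P.sub_subset hN k) fun _ hx =>
    mem_iUnion.2 (P.exists_mem_sub hN hx)

lemma disjoint_sub (P : Cube n) {N : ℕ} (hN : 0 < N) {k m : Fin n → Fin N} (h : k ≠ m) :
    Disjoint (P.sub hN k).set (P.sub hN m).set := by
  rw [Set.disjoint_left]
  intro x hx hy
  apply h
  ext i
  have h1 := (P.mem_sub hN k).1 hx i
  have h2 := (P.mem_sub hN m).1 hy i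
  have h3 : ((k i : ℕ) : ℝ) < (m i : ℕ) + 1 := h1.1.trans_lt h2.2
  have h4 : ((m i : ℕ) : ℝ) < (k i : ℕ) + 1 := h2.1.trans_lt h1.2
  have h5 : (k i : ℕ) < m i + 1 := by exact_mod_cast h3
  have h6 : (m i : ℕ) < k i + 1 := by exact_mod_cast h4
  omega

lemma volume_real_inter_eq_sum (P : Cube n) {N : ℕ} (hN : 0 < N)
    {A : Set (EuclideanSpace ℝ (Fin n))} (hA : MeasurableSet A) :
    volume.real (A ∩ P.set) = ∑ k, volume.real (A ∩ (P.sub hN k).set) := by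
  rw [← P.iUnion_sub hN, inter_iUnion]
  exact measureReal_iUnion_fintype
    (fun k m h => (P.disjoint_sub hN h).mono inter_subset_right inter_subset_right)
    (fun k => hA.inter (measurableSet_set _))
    (fun k => measure_ne_top_of_subset inter_subset_right (volume_ne_top _))

lemma sub_isDyadicSubcube (P : Cube n) (j : ℕ) (k : Fin n → Fin (2 ^ j)) :
    IsDyadicSubcube P (P.sub (Nat.two_pow_pos j) k) :=
  ⟨j, fun i => k i, fun i => (k i).2, by simp [sub], fun i => by simp [sub]⟩

end Cube

lemma IsDyadicSubcube.side_le {n : ℕ} {P Q : Cube n} (h : IsDyadicSubcube P Q) : Q.l ≤ P.l := by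
  obtain ⟨j, k, -, h, -⟩ := h
  rw [h]
  exact div_le_self P.pos.le (one_le_pow₀ one_le_two)

lemma IsDyadicSubcube.subset {n : ℕ} {P Q : Cube n} (h : IsDyadicSubcube P Q) :
    Q.set ⊆ P.set := by
  obtain ⟨j, k, hk, hl, ha⟩ := h
  have hQ : Q = P.sub (Nat.two_pow_pos j) fun i => ⟨k i, hk i⟩ :=
    Cube.ext_of_corner (fun i => by simpa [Cube.sub] using ha i) (by simpa [Cube.sub] using hl)
  rw [hQ]
  exact P.sub_subset _ _

/-- The supremum over a cube of the distance to `E`. -/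
noncomputable def Cube.distSup {n : ℕ} (P : Cube n) (E : Set (EuclideanSpace ℝ (Fin n))) : ℝ :=
  sSup ((fun x => infDist x E) '' P.set)

/-- In every cube, the points whose distance to `E` is comparable to the largest distance to `E`
within the cube fill a fixed proportion of the cube. -/
def FarWith {n : ℕ} (E : Set (EuclideanSpace ℝ (Fin n))) (c δ : ℝ) : Prop :=
  ∀ P : Cube n, 0 < P.distSup E ∧
    c * volume.real P.set ≤ volume.real ({x | δ * P.distSup E ≤ infDist x E} ∩ P.set)

section

variable {n : ℕ} {E : Set (EuclideanSpace ℝ (Fin n))}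

namespace Cube

lemma infDist_le_add (P : Cube n) {x y : EuclideanSpace ℝ (Fin n)} (hx : x ∈ P.set)
    (hy : y ∈ P.set) : infDist x E ≤ infDist y E + √n * P.l :=
  infDist_le_infDist_add_dist.trans (by gcongr; exact P.dist_le hx hy)

lemma bddAbove_infDist (P : Cube n) : BddAbove ((fun x => infDist x E) '' P.set) := by
  obtain ⟨y, hy⟩ := P.nonempty_set
  refine ⟨infDist y E + √n * P.l, ?_⟩
  rintro _ ⟨x, hx, rfl⟩
  exact P.infDist_le_add hx hy

lemma infDist_le_distSup (P : Cube n) {x : EuclideanSpace ℝ (Fin n)} (hx : x ∈ P.set) :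
    infDist x E ≤ P.distSup E :=
  le_csSup P.bddAbove_infDist ⟨x, hx, rfl⟩

lemma exists_lt_infDist (P : Cube n) {s : ℝ} (hs : s < P.distSup E) :
    ∃ x ∈ P.set, s < infDist x E := by
  obtain ⟨_, ⟨x, hx, rfl⟩, h⟩ := exists_lt_of_lt_csSup (P.nonempty_set.image _) hs
  exact ⟨x, hx, h⟩

lemma distSup_le_add (P : Cube n) {x : EuclideanSpace ℝ (Fin n)} (hx : x ∈ P.set) :
    P.distSup E ≤ infDist x E + √n * P.l := by
  refine csSup_le (P.nonempty_set.image _) ?_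
  rintro _ ⟨y, hy, rfl⟩
  exact P.infDist_le_add hy hx

lemma distSup_nonneg (P : Cube n) : 0 ≤ P.distSup E := by
  obtain ⟨y, hy⟩ := P.nonempty_set
  exact infDist_nonneg.trans (P.infDist_le_distSup hy)

lemma exists_scale (P : Cube n) {s : ℝ} (hs : 0 < s) :
    ∃ j : ℕ, √n * (P.l / 2 ^ j) ≤ s ∧ (j = 0 ∨ s < 2 * (√n * (P.l / 2 ^ j))) := by
  classical
  have hex : ∃ j : ℕ, √n * (P.l / 2 ^ j) ≤ s := by
    obtain ⟨j, hj⟩ := pow_unbounded_of_one_lt (√n * P.l / s) one_lt_two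
    refine ⟨j, ?_⟩
    rw [div_lt_iff₀ hs] at hj
    rw [← mul_div_assoc, div_le_iff₀ (by positivity)]
    linarith
  refine ⟨Nat.find hex, Nat.find_spec hex, ?_⟩
  rcases h : Nat.find hex with _ | j
  · exact Or.inl rfl
  · right
    have := Nat.find_min hex (m := j) (by omega)
    push Not at this
    have heq : 2 * (√n * (P.l / 2 ^ (j + 1))) = √n * (P.l / 2 ^ j) := by
      rw [pow_succ]; field_simp
    rwa [heq]

end Cube

lemma le_infDist_of_eFree (hne : E.Nonempty) {Q : Cube n} (hQ : EFree E Q) {r : ℝ}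
    {x : EuclideanSpace ℝ (Fin n)}
    (hx : ∀ i, Q.a i + r ≤ x i ∧ x i + r ≤ Q.a i + Q.l) : r ≤ infDist x E := by
  rw [le_infDist hne]
  intro y hy
  by_contra! h
  refine (Set.eq_empty_iff_forall_notMem.1 hQ y) ⟨fun i => ?_, hy⟩
  have h1 : |x i - y i| ≤ dist x y := by
    rw [dist_eq_norm]; exact PiLp.norm_apply_le (x - y) i
  have h2 := abs_lt.1 (h1.trans_lt h)
  constructor <;> linarith [(hx i).1, (hx i).2]

lemma le_infDist_of_mem_middle (hne : E.Nonempty) {Q : Cube n} (hQ : EFree E Q)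
    {x : EuclideanSpace ℝ (Fin n)} (hx : x ∈ Q.middle.set) : Q.l / 4 ≤ infDist x E := by
  refine le_infDist_of_eFree hne hQ fun i => ?_
  have h := hx i
  simp only [Cube.middle] at h
  constructor <;> linarith [h.1, h.2]

lemma eFree_of_lt_infDist {Q : Cube n} {x : EuclideanSpace ℝ (Fin n)} (hx : x ∈ Q.set)
    (h : √n * Q.l < infDist x E) : EFree E Q := by
  refine Set.eq_empty_iff_forall_notMem.2 fun y ⟨hy, hyE⟩ => ?_
  exact (Q.dist_le hx hy).not_gt (h.trans_le (infDist_le_dist_of_mem hyE))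

lemma measurableSet_le_infDist (s : ℝ) : MeasurableSet {x | s ≤ infDist x E} :=
  (isClosed_le continuous_const (continuous_infDist_pt E)).measurableSet

lemma measurableSet_infDist_le (s : ℝ) : MeasurableSet {x | infDist x E ≤ s} :=
  (isClosed_le (continuous_infDist_pt E) continuous_const).measurableSet

lemma measurableSet_infDist_lt (s : ℝ) : MeasurableSet {x | infDist x E < s} :=
  (isOpen_lt (continuous_infDist_pt E) continuous_const).measurableSet

lemma bddAbove_maxFree (P : Cube n) : BddAbove
    {v : ℝ | ∃ Q : Cube n, IsDyadicSubcube P Q ∧ EFree E Q ∧ v = (volume Q.set).toReal} := by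
  refine ⟨P.l ^ n, ?_⟩
  rintro _ ⟨Q, hQ, -, rfl⟩
  rw [Q.volume_toReal]
  exact pow_le_pow_left₀ Q.pos.le hQ.side_le n

/-- A point at distance more than half of the largest distance to `E` produces a free dyadic
subcube, unless the cube is uniformly far away from `E`. -/
lemma quarter_le_infDist_or_le_maxFree {P : Cube n} (hD : 0 < P.distSup E) :
    (∀ x ∈ P.set, P.distSup E / 4 ≤ infDist x E) ∨
      ∃ s, P.distSup E / 4 < 2 * (√n * s) ∧ 0 < s ∧ s ^ n ≤ maxFree E P := by
  obtain ⟨j, hj, hj'⟩ := P.exists_scale (s := P.distSup E / 4) (by linarith)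
  rcases hj' with rfl | hj'
  · left
    intro x hx
    have := P.distSup_le_add (E := E) hx
    simp only [pow_zero, div_one] at hj
    linarith
  · right
    refine ⟨P.l / 2 ^ j, hj', div_pos P.pos (by positivity), ?_⟩
    obtain ⟨x, hx, hxD⟩ := P.exists_lt_infDist (E := E) (s := P.distSup E / 2) (by linarith)
    obtain ⟨k, hk⟩ := P.exists_mem_sub (Nat.two_pow_pos j) hx
    have hl : (P.sub (Nat.two_pow_pos j) k).l = P.l / 2 ^ j := by simp [Cube.sub]
    refine le_csSup (bddAbove_maxFree P)
      ⟨_, P.sub_isDyadicSubcube j k, eFree_of_lt_infDist hk ?_, ?_⟩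
    · rw [hl]; linarith
    · rw [Cube.volume_toReal, hl]

lemma WeaklyPorousWith.farWith (hn : 0 < n) (hne : E.Nonempty) {c δ : ℝ} (hc : 0 < c)
    (hc1 : c < 1) (hδ : 0 < δ) (hδ1 : δ < 1) (h : WeaklyPorousWith E c δ) :
    FarWith E (c / 2 ^ n) (δ / (32 * √n)) := by
  intro P
  have hn1 : (1 : ℝ) ≤ √n := Real.one_le_sqrt.2 (by exact_mod_cast hn)
  obtain ⟨N, Q, hQ, hdisj, hsize, hsum⟩ := h P
  simp only [Cube.volume_toReal] at hsize hsum
  have hD : 0 < P.distSup E := by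
    have hN : N ≠ 0 := by
      rintro rfl
      simp only [Finset.univ_eq_empty, Finset.sum_empty] at hsum
      exact (mul_pos hc (pow_pos P.pos n)).not_ge hsum
    let k : Fin N := ⟨0, Nat.pos_of_ne_zero hN⟩
    obtain ⟨x, hx⟩ := (Q k).middle.nonempty_set
    refine lt_of_lt_of_le ?_ ((le_infDist_of_mem_middle hne (hQ k).2 hx).trans
      (P.infDist_le_distSup ((hQ k).1.subset ((Q k).middle_subset hx))))
    linarith [(Q k).pos]
  refine ⟨hD, ?_⟩
  rcases quarter_le_infDist_or_le_maxFree hD with hfar | ⟨s, hs, hs0, hsM⟩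
  · have heq : {x | δ / (32 * √n) * P.distSup E ≤ infDist x E} ∩ P.set = P.set := by
      refine inter_eq_right.2 fun x hx => ?_
      refine le_trans ?_ (hfar x hx)
      rw [div_mul_eq_mul_div, div_le_div_iff₀ (by positivity) (by norm_num)]
      nlinarith
    rw [heq]
    refine mul_le_of_le_one_left (P.volume_real_pos).le ?_
    exact div_le_one_of_le₀ (hc1.le.trans (one_le_pow₀ one_le_two)) (by positivity)
  · have hside : ∀ k, δ * s ≤ (Q k).l := fun k => by
      refine le_of_pow_le_pow_left₀ hn.ne' (Q k).pos.le ?_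
      calc (δ * s) ^ n = δ ^ n * s ^ n := mul_pow _ _ _
        _ ≤ δ * maxFree E P := by
          gcongr
          exact pow_le_of_le_one hδ.le hδ1.le hn.ne'
        _ ≤ _ := hsize k
    have hsub : (⋃ k, (Q k).middle.set) ⊆
        {x | δ / (32 * √n) * P.distSup E ≤ infDist x E} ∩ P.set := by
      refine iUnion_subset fun k x hx =>
        ⟨le_trans ?_ (le_infDist_of_mem_middle hne (hQ k).2 hx),
          (hQ k).1.subset ((Q k).middle_subset hx)⟩
      rw [div_mul_eq_mul_div, div_le_div_iff₀ (by positivity) (by norm_num)]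
      have h1 := hside k
      have h2 : δ * P.distSup E ≤ δ * (8 * (√n * s)) := by gcongr; linarith
      have h3 : √n * (δ * s) ≤ √n * (Q k).l := by gcongr
      linarith
    calc c / 2 ^ n * volume.real P.set ≤ (∑ k, (Q k).l ^ n) / 2 ^ n := by
          rw [P.volume_real, div_mul_eq_mul_div]; gcongr
      _ = ∑ k, volume.real (Q k).middle.set := by
          rw [Finset.sum_div]
          refine Finset.sum_congr rfl fun k _ => ?_
          rw [Cube.volume_real, Cube.middle, div_pow]
      _ = volume.real (⋃ k, (Q k).middle.set) :=
          (measureReal_iUnion_fintype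
            (fun k m hkm => (hdisj k m hkm).mono (Cube.middle_subset _) (Cube.middle_subset _))
            (fun k => Cube.measurableSet_set _) (fun k => Cube.volume_ne_top _)).symm
      _ ≤ _ := measureReal_mono hsub (measure_ne_top_of_subset inter_subset_right P.volume_ne_top)

lemma maxFree_le (hne : E.Nonempty) (P : Cube n) :
    ∃ m, 0 ≤ m ∧ m ≤ P.l ∧ m ≤ 4 * P.distSup E ∧ maxFree E P ≤ m ^ n := by
  refine ⟨min P.l (4 * P.distSup E), le_min P.pos.le (by linarith [P.distSup_nonneg (E := E)]),
    min_le_left _ _, min_le_right _ _, ?_⟩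
  refine Real.sSup_le ?_ (pow_nonneg (le_min P.pos.le
    (by linarith [P.distSup_nonneg (E := E)])) n)
  rintro _ ⟨Q, hQ, hfree, rfl⟩
  rw [Q.volume_toReal]
  refine pow_le_pow_left₀ Q.pos.le (le_min hQ.side_le ?_) n
  obtain ⟨x, hx⟩ := Q.middle.nonempty_set
  have h1 := le_infDist_of_mem_middle hne hfree hx
  have h2 := P.infDist_le_distSup (E := E) (hQ.subset (Q.middle_subset hx))
  linarith

lemma FarWith.weaklyPorousWith (hn : 0 < n) (hne : E.Nonempty) {c δ : ℝ}
    (hδ : 0 < δ) (hδ1 : δ ≤ 1) (h : FarWith E c δ) :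
    WeaklyPorousWith E c ((δ / (16 * √n)) ^ n) := by
  classical
  intro P
  have hn1 : (1 : ℝ) ≤ √n := Real.one_le_sqrt.2 (by exact_mod_cast hn)
  have hD := (h P).1
  obtain ⟨j, hj, hj'⟩ := P.exists_scale (s := δ * P.distSup E / 2) (by positivity)
  set sub := P.sub (Nat.two_pow_pos j) with hsub
  have hl : ∀ k, (sub k).l = P.l / 2 ^ j := fun k => by simp [hsub, Cube.sub]
  let S : Finset (Fin n → Fin (2 ^ j)) :=
    Finset.univ.filter fun k => ∃ x ∈ (sub k).set, δ * P.distSup E ≤ infDist x E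
  refine ⟨S.card, fun i => sub (S.equivFin.symm i), fun i => ⟨P.sub_isDyadicSubcube j _, ?_⟩,
    fun i i' hii' => P.disjoint_sub _ fun heq => hii' ?_, fun i => ?_, ?_⟩
  · obtain ⟨x, hx, hxD⟩ := (Finset.mem_filter.1 (S.equivFin.symm i).2).2
    refine eFree_of_lt_infDist hx ?_
    rw [hl]
    have := mul_pos hδ hD
    linarith
  · exact S.equivFin.symm.injective (Subtype.ext heq)
  · obtain ⟨m, hm0, hmP, hmD, hM⟩ := maxFree_le hne P
    rw [Cube.volume_toReal, hl]
    calc (δ / (16 * √n)) ^ n * maxFree E P ≤ (δ / (16 * √n)) ^ n * m ^ n := by gcongr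
      _ = (δ / (16 * √n) * m) ^ n := (mul_pow _ _ _).symm
      _ ≤ (P.l / 2 ^ j) ^ n := by
        refine pow_le_pow_left₀ (by positivity) ?_ n
        rw [div_mul_eq_mul_div, div_le_iff₀ (by positivity)]
        rcases hj' with rfl | hj'
        · rw [pow_zero, div_one]
          have := P.pos
          calc δ * m ≤ 1 * P.l := by gcongr
            _ ≤ P.l * (16 * √n) := by nlinarith
        · have : δ * m ≤ δ * (4 * P.distSup E) := by gcongr
          linarith
  · simp only [Cube.volume_toReal, hl]
    rw [← P.volume_real, Finset.sum_const, Finset.card_univ, Fintype.card_fin]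
    refine (h P).2.trans ?_
    have hcov : {x | δ * P.distSup E ≤ infDist x E} ∩ P.set ⊆ ⋃ k ∈ S, (sub k).set := by
      rintro x ⟨hx, hxP⟩
      obtain ⟨k, hk⟩ := P.exists_mem_sub (Nat.two_pow_pos j) hxP
      exact mem_iUnion₂.2 ⟨k, Finset.mem_filter.2 ⟨Finset.mem_univ _, x, hk, hx⟩, hk⟩
    refine (measureReal_mono hcov ?_).trans ((measureReal_biUnion_finset_le _ _).trans ?_)
    · exact measure_ne_top_of_subset (iUnion₂_subset fun k _ => P.sub_subset _ k) P.volume_ne_top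
    · simp [Cube.volume_real, hl]

lemma FarWith.mul_distSup_le_of_subset {c δ : ℝ} (h : FarWith E c δ) {R P : Cube n}
    (hRP : R.set ⊆ P.set) (hvol : (1 - c) * volume.real P.set < volume.real R.set) :
    δ * P.distSup E ≤ R.distSup E := by
  by_contra! hlt
  have hdisj : Disjoint ({x | δ * P.distSup E ≤ infDist x E} ∩ P.set) R.set :=
    Set.disjoint_left.2 fun x hx hxR =>
      (hx.1.trans (R.infDist_le_distSup hxR)).not_gt hlt
  have h1 : volume.real (({x | δ * P.distSup E ≤ infDist x E} ∩ P.set) ∪ R.set) ≤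
      volume.real P.set :=
    measureReal_mono (union_subset inter_subset_right hRP) P.volume_ne_top
  rw [measureReal_union hdisj R.measurableSet_set
    (measure_ne_top_of_subset inter_subset_right P.volume_ne_top) R.volume_ne_top] at h1
  linarith [(h P).2]

lemma FarWith.exists_mul_distSup_le_sub {c δ : ℝ} (h : FarWith E c δ) (hc : 0 < c)
    (hδ : 0 < δ) (hδ1 : δ ≤ 1) :
    ∃ η : ℝ, 0 < η ∧ η ≤ 1 ∧ ∀ (P : Cube n) (k : Fin n → Fin 2),
      η * P.distSup E ≤ (P.sub two_pos k).distSup E := by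
  obtain ⟨N, hN⟩ := exists_nat_gt (n / c)
  have hN0 : (0 : ℝ) < N := lt_of_le_of_lt (by positivity) hN
  rw [div_lt_iff₀ hc] at hN
  refine ⟨δ ^ N, pow_pos hδ N, pow_le_one₀ hδ.le hδ1, fun P k => ?_⟩
  obtain ⟨R, hR⟩ : ∃ R, R = P.sub two_pos k := ⟨_, rfl⟩
  rw [← hR]
  have hRl : P.l = 2 * R.l := by simp [hR, Cube.sub]; ring
  have hRa : ∀ i, P.a i ≤ R.a i ∧ R.a i ≤ P.a i + R.l := fun i => by
    have h0 : (0 : ℝ) ≤ (k i : ℕ) := Nat.cast_nonneg _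
    have h1 : ((k i : ℕ) : ℝ) ≤ 1 := by exact_mod_cast Nat.le_of_lt_succ (k i).2
    have := P.pos
    simp only [hR, Cube.sub, Nat.cast_ofNat]
    constructor <;> nlinarith
  have hRpos := R.pos
  let T : ℕ → Cube n := fun m =>
    { a := WithLp.toLp 2 fun i => R.a i - m / N * (R.a i - P.a i)
      l := R.l * (1 + m / N)
      pos := by positivity }
  have hT0 : T 0 = R := by
    exact Cube.ext_of_corner (fun i => by simp [T]) (by simp [T])
  have hTN : T N = P := by
    refine Cube.ext_of_corner (fun i => ?_) ?_
    · simp [T, div_self hN0.ne']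
    · simp only [T, div_self hN0.ne']
      linarith
  have hstep : ∀ m, δ * (T (m + 1)).distSup E ≤ (T m).distSup E := fun m => by
    have hm0 : (0 : ℝ) ≤ m := Nat.cast_nonneg m
    apply h.mul_distSup_le_of_subset
    · intro x hx i
      have hx := hx i
      have h1 := hRa i
      simp only [T, Nat.cast_add, Nat.cast_one] at hx ⊢
      have hinv : 0 < 1 / (N : ℝ) := by positivity
      have e : ((m : ℝ) + 1) / N = m / N + 1 / N := add_div _ _ _
      rw [e]
      constructor
      · nlinarith [hx.1]
      · nlinarith [hx.2]
    · rw [Cube.volume_real, Cube.volume_real]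
      have hpos : (0 : ℝ) < N + m + 1 := by positivity
      have e1 : (T m).l = (1 + -(1 / (N + m + 1))) * (T (m + 1)).l := by
        simp only [T]; push_cast; field_simp; ring
      rw [e1, mul_pow (1 + -(1 / ((N : ℝ) + m + 1)))]
      refine mul_lt_mul_of_pos_right ?_ (pow_pos (T (m + 1)).pos n)
      have hle1 : 1 / ((N : ℝ) + m + 1) ≤ 1 := by
        rw [div_le_one hpos]; linarith [Nat.one_le_cast (α := ℝ).2 (Nat.cast_pos.1 hN0)]
      refine lt_of_lt_of_le ?_ (one_add_mul_le_pow (by linarith) n)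
      have : (n : ℝ) * (1 / (N + m + 1)) < c := by
        rw [mul_one_div, div_lt_iff₀ hpos]; nlinarith
      linarith
  have hchain : ∀ m, δ ^ m * (T m).distSup E ≤ R.distSup E := fun m => by
    induction m with
    | zero => simp [hT0]
    | succ m ih =>
      calc δ ^ (m + 1) * (T (m + 1)).distSup E = δ ^ m * (δ * (T (m + 1)).distSup E) := by ring
        _ ≤ δ ^ m * (T m).distSup E := by gcongr; exact hstep m
        _ ≤ _ := ih
  simpa only [hTN] using hchain N

/-- If a set of points close to `E` has density at most `θ` in all cubes `R` with
`η * s ≤ R.distSup E < s`, then it has density at most `θ` in the part of a larger cube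
where the distance to `E` is less than `s`. -/
lemma volume_real_inter_le_of_distSup {η s θ : ℝ} (hθ : 0 ≤ θ)
    (hη : ∀ (P : Cube n) (k : Fin n → Fin 2),
      η * P.distSup E ≤ (P.sub two_pos k).distSup E) (hη0 : 0 < η)
    {A : Set (EuclideanSpace ℝ (Fin n))} (hA : MeasurableSet A)
    (hAs : ∀ x ∈ A, infDist x E ≤ s / 2)
    (hθA : ∀ R : Cube n, η * s ≤ R.distSup E → R.distSup E < s →
      volume.real (A ∩ R.set) ≤ θ * volume.real R.set) (j : ℕ) :
    ∀ P : Cube n, s ≤ P.distSup E → √n * (P.l / 2 ^ j) < s / 2 →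
      volume.real (A ∩ P.set) ≤ θ * volume.real ({x | infDist x E < s} ∩ P.set) := by
  induction j with
  | zero =>
    intro P hP hj
    have : A ∩ P.set = ∅ := Set.eq_empty_iff_forall_notMem.2 fun x ⟨hxA, hxP⟩ => by
      have h1 := P.distSup_le_add (E := E) hxP
      have h2 := hAs x hxA
      simp only [pow_zero, div_one] at hj
      linarith
    rw [this, measureReal_empty]
    positivity
  | succ j ih =>
    intro P hP hj
    rw [P.volume_real_inter_eq_sum two_pos hA,
      P.volume_real_inter_eq_sum two_pos (measurableSet_infDist_lt s), Finset.mul_sum]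
    refine Finset.sum_le_sum fun k _ => ?_
    rcases le_or_gt s ((P.sub two_pos k).distSup E) with hs | hs
    · refine ih _ hs (lt_of_eq_of_lt ?_ hj)
      simp only [Cube.sub, pow_succ, Nat.cast_ofNat]
      field_simp
    · have heq : {x | infDist x E < s} ∩ (P.sub two_pos k).set = (P.sub two_pos k).set :=
        inter_eq_right.2 fun x hx => (Cube.infDist_le_distSup _ hx).trans_lt hs
      rw [heq]
      refine hθA _ (le_trans ?_ (hη P k)) hs
      gcongr

lemma FarWith.volume_real_infDist_lt_le {c δ : ℝ} (h : FarWith E c δ) (P : Cube n) :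
    volume.real ({x | infDist x E < δ * P.distSup E} ∩ P.set) ≤ (1 - c) * volume.real P.set := by
  have heq : {x | infDist x E < δ * P.distSup E} ∩ P.set =
      P.set \ ({x | δ * P.distSup E ≤ infDist x E} ∩ P.set) := by
    ext x
    simp only [mem_inter_iff, mem_ofPred_eq, mem_sdiff, not_and, ← not_le]
    tauto
  rw [heq, measureReal_sdiff inter_subset_right
    ((measurableSet_le_infDist _).inter P.measurableSet_set) P.volume_ne_top]
  linarith [(h P).2]

lemma FarWith.exists_volume_real_infDist_le {c δ : ℝ} (h : FarWith E c δ) (hc : 0 < c)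
    (hc1 : c < 1) (hδ : 0 < δ) (hδ1 : δ ≤ 1) :
    ∃ κ : ℝ, 0 < κ ∧ κ < 1 ∧ ∀ (k : ℕ) (P : Cube n),
      volume.real ({x | infDist x E ≤ κ ^ k * P.distSup E} ∩ P.set) ≤
        (1 - c) ^ k * volume.real P.set := by
  obtain ⟨η, hη0, hη1, hη⟩ := h.exists_mul_distSup_le_sub hc hδ hδ1
  have hκδ : δ * η / 2 ≤ δ / 2 := by nlinarith
  have hκ0 : 0 < δ * η / 2 := by positivity
  refine ⟨δ * η / 2, hκ0, by linarith, fun k => ?_⟩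
  have hc' : 0 ≤ 1 - c := by linarith
  induction k with
  | zero =>
    intro P
    simpa using measureReal_mono inter_subset_right P.volume_ne_top
  | succ k ih =>
    intro P
    have hD := (h P).1
    have hs : 0 < δ * P.distSup E := mul_pos hδ hD
    obtain ⟨j, hj, -⟩ := P.exists_scale (s := δ * P.distSup E / 4) (by linarith)
    refine (volume_real_inter_le_of_distSup (s := δ * P.distSup E) (pow_nonneg hc' k) hη hη0
      (measurableSet_infDist_le _) (fun x hx => hx.out.trans ?_) (fun R hR _ => ?_) j P
      (mul_le_of_le_one_left hD.le hδ1) (by linarith)).trans ?_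
    · have : (δ * η / 2) ^ (k + 1) ≤ δ / 2 :=
        (pow_le_of_le_one hκ0.le (by linarith) k.succ_ne_zero).trans hκδ
      nlinarith
    · refine (measureReal_mono (inter_subset_inter_left _ fun x hx => hx.out.trans ?_)
        (measure_ne_top_of_subset inter_subset_right R.volume_ne_top)).trans (ih R)
      rw [pow_succ, mul_assoc]
      gcongr
      nlinarith
    · rw [pow_succ, mul_assoc]
      gcongr
      exact h.volume_real_infDist_lt_le P

lemma distw_nonneg (α : ℝ) (x : EuclideanSpace ℝ (Fin n)) : 0 ≤ distw E α x :=
  Real.rpow_nonneg infDist_nonneg _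

lemma measurable_distw (α : ℝ) : Measurable (distw E α) :=
  (continuous_infDist_pt E).measurable.pow_const _

lemma Cube.exists_mem_nhds (x : EuclideanSpace ℝ (Fin n)) : ∃ P : Cube n, P.set ∈ nhds x := by
  refine ⟨⟨WithLp.toLp 2 fun i => x i - 1, 2, two_pos⟩, ?_⟩
  refine Filter.mem_of_superset (Metric.ball_mem_nhds x one_pos) fun y hy i => ?_
  have h1 : |y i - x i| ≤ dist y x := by
    rw [dist_eq_norm]; exact PiLp.norm_apply_le (y - x) i
  have h2 := abs_lt.1 (h1.trans_lt hy)
  simp only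
  constructor <;> linarith [h2.1, h2.2]

lemma FarWith.ae_infDist_pos {c δ : ℝ} (h : FarWith E c δ) (hc : 0 < c)
    (hc1 : c < 1) (hδ : 0 < δ) (hδ1 : δ ≤ 1) :
    ∀ᵐ x ∂(volume : Measure (EuclideanSpace ℝ (Fin n))), 0 < infDist x E := by
  obtain ⟨κ, hκ0, hκ1, hκ⟩ := h.exists_volume_real_infDist_le hc hc1 hδ hδ1
  refine measure_null_of_locally_null _ fun x _ => ?_
  obtain ⟨P, hP⟩ := Cube.exists_mem_nhds x
  refine ⟨_, Filter.inter_mem self_mem_nhdsWithin (mem_nhdsWithin_of_mem_nhds hP), ?_⟩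
  have hfin : volume ({x | ¬ 0 < infDist x E} ∩ P.set) ≠ ⊤ :=
    measure_ne_top_of_subset inter_subset_right P.volume_ne_top
  refine (measureReal_eq_zero_iff hfin).1 (le_antisymm ?_ measureReal_nonneg)
  have hlim : Filter.Tendsto (fun k : ℕ => (1 - c) ^ k * volume.real P.set) Filter.atTop
      (nhds (0 * volume.real P.set)) :=
    (tendsto_pow_atTop_nhds_zero_of_lt_one (by linarith) (by linarith)).mul_const _
  rw [zero_mul] at hlim
  refine ge_of_tendsto' hlim fun k => le_trans (measureReal_mono ?_ ?_) (hκ k P)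
  · refine inter_subset_inter_left _ fun y hy => (not_lt.1 hy).trans ?_
    exact mul_nonneg (pow_nonneg hκ0.le k) P.distSup_nonneg
  · exact measure_ne_top_of_subset inter_subset_right P.volume_ne_top

lemma distw_anti {α : ℝ} (hα : 0 < α) {x : EuclideanSpace ℝ (Fin n)} {s : ℝ} (hs : 0 < s)
    (hx : s ≤ infDist x E) : distw E α x ≤ s ^ (-α) :=
  Real.rpow_le_rpow_of_nonpos hs hx (by linarith)

lemma FarWith.exists_lintegral_distw_le {c δ : ℝ} (h : FarWith E c δ) (hc : 0 < c)
    (hc1 : c < 1) (hδ : 0 < δ) (hδ1 : δ ≤ 1) :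
    ∃ α C : ℝ, 0 < α ∧ 0 < C ∧ ∀ P : Cube n,
      ∫⁻ x in P.set, ENNReal.ofReal (distw E α x) ≤
        ENNReal.ofReal (C * P.distSup E ^ (-α) * volume.real P.set) := by
  obtain ⟨κ, hκ0, hκ1, hκ⟩ := h.exists_volume_real_infDist_le hc hc1 hδ hδ1
  obtain ⟨r, hr⟩ : ∃ r, r = √(1 - c) := ⟨_, rfl⟩
  have hr0 : 0 < r := hr ▸ Real.sqrt_pos.2 (by linarith)
  have hr1 : r < 1 := hr ▸ (Real.sqrt_lt' one_pos).2 (by linarith)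
  have hr2 : 1 - c = r ^ 2 := by rw [hr, Real.sq_sqrt (by linarith)]
  have hα : 0 < Real.logb κ r := Real.logb_pos_of_base_lt_one hκ0 hκ1 hr0 hr1
  refine ⟨Real.logb κ r, (1 - r)⁻¹ * r⁻¹, hα, by
    have := sub_pos.2 hr1
    positivity, fun P => ?_⟩
  have hκα : ∀ k : ℕ, (κ ^ k) ^ (-Real.logb κ r) = (r ^ k)⁻¹ := fun k => by
    rw [Real.rpow_neg (pow_nonneg hκ0.le k), ← Real.rpow_natCast, ← Real.rpow_mul hκ0.le,
      mul_comm, Real.rpow_mul hκ0.le, Real.rpow_logb hκ0 hκ1.ne hr0, Real.rpow_natCast]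
  generalize Real.logb κ r = α at hα hκα
  have hD := (h P).1
  have hDα : 0 ≤ P.distSup E ^ (-α) := Real.rpow_nonneg hD.le _
  let b : ℕ → ℝ := fun k => (r ^ (k + 1))⁻¹ * P.distSup E ^ (-α)
  have hb : ∀ k, 0 ≤ b k := fun k => by positivity
  let A : ℕ → Set (EuclideanSpace ℝ (Fin n)) := fun k => {x | infDist x E ≤ κ ^ k * P.distSup E}
  have hpt : ∀ x ∈ P.set, ENNReal.ofReal (distw E α x) ≤
      ∑' k, (A k).indicator (fun _ => ENNReal.ofReal (b k)) x := fun x hx => by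
    rcases (infDist_nonneg (x := x) (s := E)).eq_or_lt' with h0 | h0
    · simp [distw, h0, Real.zero_rpow (neg_ne_zero.2 hα.ne')]
    · obtain ⟨k, hk1, hk2⟩ := exists_nat_pow_near_of_lt_one (div_pos h0 hD)
        ((div_le_one hD).2 (P.infDist_le_distSup hx)) hκ0 hκ1
      rw [lt_div_iff₀ hD] at hk1
      rw [div_le_iff₀ hD] at hk2
      refine le_trans ?_ (ENNReal.le_tsum k)
      rw [indicator_of_mem (show x ∈ A k from hk2)]
      refine ENNReal.ofReal_le_ofReal ((distw_anti hα (by positivity) hk1.le).trans_eq ?_)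
      rw [Real.mul_rpow (by positivity) hD.le, hκα]
  have hterm : ∀ k, ∫⁻ x in P.set, (A k).indicator (fun _ => ENNReal.ofReal (b k)) x ≤
      ENNReal.ofReal (r ^ k * (r⁻¹ * P.distSup E ^ (-α) * volume.real P.set)) := fun k => by
    rw [lintegral_indicator_const (measurableSet_infDist_le _),
      Measure.restrict_apply (measurableSet_infDist_le _),
      ← ofReal_measureReal (measure_ne_top_of_subset inter_subset_right P.volume_ne_top),
      ← ENNReal.ofReal_mul (hb k)]
    refine ENNReal.ofReal_le_ofReal ((mul_le_mul_of_nonneg_left (hκ k P) (hb k)).trans_eq ?_)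
    simp only [b]
    rw [hr2]
    field_simp
    ring
  calc ∫⁻ x in P.set, ENNReal.ofReal (distw E α x)
      ≤ ∫⁻ x in P.set, ∑' k, (A k).indicator (fun _ => ENNReal.ofReal (b k)) x :=
        setLIntegral_mono' P.measurableSet_set hpt
    _ = ∑' k, ∫⁻ x in P.set, (A k).indicator (fun _ => ENNReal.ofReal (b k)) x :=
        lintegral_tsum fun k =>
          (measurable_const.indicator (measurableSet_infDist_le _)).aemeasurable
    _ ≤ ∑' k, ENNReal.ofReal (r ^ k * (r⁻¹ * P.distSup E ^ (-α) * volume.real P.set)) :=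
        ENNReal.tsum_le_tsum hterm
    _ = _ := by
      rw [← ENNReal.ofReal_tsum_of_nonneg (fun k => by positivity)
        ((summable_geometric_of_lt_one hr0.le hr1).mul_right _), tsum_mul_right,
        tsum_geometric_of_lt_one hr0.le hr1]
      congr 1
      ring

lemma Cube.neBot_ae_restrict (P : Cube n) : (ae (volume.restrict P.set)).NeBot := by
  rw [ae_neBot, Ne, Measure.restrict_eq_zero]
  intro h
  have := P.volume_real_pos
  rw [measureReal_def, h] at this
  exact this.ne rfl

lemma distSup_rpow_le_essInf {α : ℝ} (hα : 0 < α) (hpos : ∀ᵐ x, 0 < infDist x E)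
    (P : Cube n) : P.distSup E ^ (-α) ≤ essInf (distw E α) (volume.restrict P.set) := by
  have := P.neBot_ae_restrict
  refine le_essInf_of_ae_le _ ?_ ?_
  · filter_upwards [ae_restrict_of_ae hpos, ae_restrict_mem P.measurableSet_set] with x hx hxP
    exact Real.rpow_le_rpow_of_nonpos hx (P.infDist_le_distSup hxP) (by linarith)
  · obtain ⟨s, hs⟩ : ∃ s, ∃ᶠ x in ae (volume.restrict P.set), distw E α x ≤ s := by
      by_contra! hcon
      have hall : ∀ᵐ x ∂(volume.restrict P.set), ∀ m : ℕ, (m : ℝ) < distw E α x :=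
        ae_all_iff.2 fun m => (hcon m).mono fun x hx => hx
      obtain ⟨x, hx⟩ := hall.exists
      obtain ⟨m, hm⟩ := exists_nat_gt (distw E α x)
      exact lt_asymm hm (hx m)
    exact Filter.IsCoboundedUnder.of_frequently_le hs

lemma FarWith.exists_memA1 {c δ : ℝ} (h : FarWith E c δ) (hc : 0 < c)
    (hc1 : c < 1) (hδ : 0 < δ) (hδ1 : δ ≤ 1) : ∃ α : ℝ, 0 < α ∧ MemA1 (distw E α) := by
  obtain ⟨α, C, hα, hC, hint⟩ := h.exists_lintegral_distw_le hc hc1 hδ hδ1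
  have hpos := h.ae_infDist_pos hc hc1 hδ hδ1
  have hmeas := (measurable_distw (E := E) α).aestronglyMeasurable (μ := volume)
  have hnn : ∀ P : Cube n, 0 ≤ C * P.distSup E ^ (-α) * volume.real P.set := fun P =>
    mul_nonneg (mul_nonneg hC.le (Real.rpow_nonneg P.distSup_nonneg _)) measureReal_nonneg
  refine ⟨α, hα, ⟨fun x => ?_, hpos.mono fun x hx => Real.rpow_pos_of_pos hx _⟩, C, fun P => ?_⟩
  · obtain ⟨P, hP⟩ := Cube.exists_mem_nhds x
    refine ⟨P.set, hP, hmeas.restrict, ?_⟩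
    rw [hasFiniteIntegral_iff_ofReal (Filter.Eventually.of_forall (distw_nonneg α))]
    exact (hint P).trans_lt ENNReal.ofReal_lt_top
  · rw [setAverage_eq, smul_eq_mul, inv_mul_le_iff₀ P.volume_real_pos,
      integral_eq_lintegral_of_nonneg_ae (Filter.Eventually.of_forall (distw_nonneg α))
        hmeas.restrict]
    refine (ENNReal.toReal_le_of_le_ofReal (hnn P) (hint P)).trans ?_
    rw [mul_comm]
    gcongr
    exact distSup_rpow_le_essInf hα hpos P

lemma essInf_distw_le {α : ℝ} (hα : 0 < α) {P : Cube n} (hD : 0 < P.distSup E) :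
    essInf (distw E α) (volume.restrict P.set) ≤ (P.distSup E / 2) ^ (-α) := by
  obtain ⟨x, hx, hxD⟩ := P.exists_lt_infDist (E := E) (half_lt_self hD)
  obtain ⟨j, hj, -⟩ := P.exists_scale (sub_pos.2 hxD)
  obtain ⟨k, hk⟩ := P.exists_mem_sub (Nat.two_pow_pos j) hx
  set Q := P.sub (Nat.two_pow_pos j) k with hQ
  have hl : Q.l = P.l / 2 ^ j := by simp [hQ, Cube.sub]
  have hQP : Q.set ⊆ P.set := P.sub_subset _ k
  refine Filter.liminf_le_of_frequently_le ?_
    ⟨0, Filter.eventually_map.2 (Filter.Eventually.of_forall (distw_nonneg α))⟩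
  have := Q.neBot_ae_restrict
  have hev : ∀ᵐ y ∂(volume.restrict Q.set), distw E α y ≤ (P.distSup E / 2) ^ (-α) := by
    filter_upwards [ae_restrict_mem Q.measurableSet_set] with y hy
    refine distw_anti hα (half_pos hD) ?_
    have h1 := Q.infDist_le_add (E := E) hk hy
    rw [hl] at h1
    linarith
  exact hev.frequently.filter_mono (ae_mono (Measure.restrict_mono hQP le_rfl))

lemma MemA1.exists_farWith {α : ℝ} (hα : 0 < α) (h : MemA1 (distw E α)) :
    ∃ δ : ℝ, 0 < δ ∧ δ ≤ 1 ∧ FarWith E (1 / 2) δ := by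
  obtain ⟨⟨hloc, hwpos⟩, C, hC⟩ := h
  have hpos : ∀ᵐ x ∂(volume : Measure (EuclideanSpace ℝ (Fin n))), 0 < infDist x E := by
    filter_upwards [hwpos] with x hx
    refine infDist_nonneg.lt_of_ne' fun h0 => ?_
    simp [distw, h0, Real.zero_rpow (neg_ne_zero.2 hα.ne')] at hx
  obtain ⟨B, hB⟩ : ∃ B, B = max C 1 * 2 ^ α * 2 := ⟨_, rfl⟩
  have hB0 : 0 < B := by
    rw [hB]
    have : 0 < max C 1 := lt_max_of_lt_right one_pos
    positivity
  obtain ⟨δ, hδ⟩ : ∃ δ, δ = min (B⁻¹ ^ α⁻¹) 1 := ⟨_, rfl⟩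
  have hδ0 : 0 < δ := hδ ▸ lt_min (Real.rpow_pos_of_pos (inv_pos.2 hB0) _) one_pos
  have hδB : B ≤ δ ^ (-α) := by
    rw [Real.rpow_neg hδ0.le, le_inv_comm₀ hB0 (Real.rpow_pos_of_pos hδ0 _)]
    calc δ ^ α ≤ (B⁻¹ ^ α⁻¹) ^ α :=
          Real.rpow_le_rpow hδ0.le (hδ ▸ min_le_left _ _) hα.le
      _ = B⁻¹ := Real.rpow_inv_rpow (inv_pos.2 hB0).le hα.ne'
  refine ⟨δ, hδ0, hδ ▸ min_le_right _ _, fun P => ?_⟩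
  have := P.neBot_ae_restrict
  have hD : 0 < P.distSup E := by
    obtain ⟨x, hx, hxP⟩ :=
      ((ae_restrict_of_ae hpos).and (ae_restrict_mem P.measurableSet_set)).exists
    exact lt_of_lt_of_le hx (P.infDist_le_distSup hxP)
  refine ⟨hD, ?_⟩
  have hint : Integrable (distw E α) (volume.restrict P.set) :=
    (hloc.integrableOn_isCompact P.isBounded_set.isCompact_closure).mono_set subset_closure
  have hcheb := mul_meas_ge_le_integral_of_nonneg
    (Filter.Eventually.of_forall (distw_nonneg α)) hint ((δ * P.distSup E) ^ (-α))
  have hDα : 0 < P.distSup E ^ (-α) := Real.rpow_pos_of_pos hD _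
  have hupper : ∫ x in P.set, distw E α x ≤ B / 2 * P.distSup E ^ (-α) * volume.real P.set := by
    have hA1 := hC P
    rw [setAverage_eq, smul_eq_mul, inv_mul_le_iff₀ P.volume_real_pos] at hA1
    refine hA1.trans ?_
    rw [mul_comm]
    refine mul_le_mul_of_nonneg_right ?_ measureReal_nonneg
    have h0 := hDα.le.trans (distSup_rpow_le_essInf hα hpos P)
    calc C * essInf (distw E α) (volume.restrict P.set)
        ≤ max C 1 * (P.distSup E / 2) ^ (-α) := by
          gcongr
          · exact le_max_left _ _
          · exact essInf_distw_le hα hD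
      _ = B / 2 * P.distSup E ^ (-α) := by
          rw [Real.div_rpow hD.le zero_le_two, Real.rpow_neg zero_le_two, hB]
          field_simp
  have hsub : volume.real ({x | infDist x E < δ * P.distSup E} ∩ P.set) ≤
      (volume.restrict P.set).real {x | (δ * P.distSup E) ^ (-α) ≤ distw E α x} := by
    rw [← measureReal_restrict_apply (measurableSet_infDist_lt _)]
    refine ENNReal.toReal_mono ?_ (measure_mono_ae ?_)
    · exact ((measure_mono (subset_univ _)).trans_lt (by
        rw [Measure.restrict_apply_univ]; exact P.volume_ne_top.lt_top)).ne
    · filter_upwards [ae_restrict_of_ae hpos] with x hx hxlt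
      exact Real.rpow_le_rpow_of_nonpos hx hxlt.le (by linarith)
  have hlt : volume.real ({x | infDist x E < δ * P.distSup E} ∩ P.set) ≤
      volume.real P.set / 2 := by
    rw [Real.mul_rpow hδ0.le hD.le] at hcheb
    have h1 : B * P.distSup E ^ (-α) *
        volume.real ({x | infDist x E < δ * P.distSup E} ∩ P.set) ≤
        B * P.distSup E ^ (-α) * (volume.real P.set / 2) := by
      calc _ ≤ δ ^ (-α) * P.distSup E ^ (-α) * (volume.restrict P.set).real
              {x | δ ^ (-α) * P.distSup E ^ (-α) ≤ distw E α x} := by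
            rw [Real.mul_rpow hδ0.le hD.le] at hsub
            gcongr
        _ ≤ _ := hcheb.trans (hupper.trans_eq (by ring))
    exact le_of_mul_le_mul_left h1 (mul_pos hB0 hDα)
  have hsplit : volume.real P.set ≤
      volume.real ({x | infDist x E < δ * P.distSup E} ∩ P.set) +
      volume.real ({x | δ * P.distSup E ≤ infDist x E} ∩ P.set) := by
    refine le_trans (measureReal_mono (fun x hx => ?_) ?_) (measureReal_union_le _ _)
    · exact (lt_or_ge (infDist x E) (δ * P.distSup E)).imp (⟨·, hx⟩) (⟨·, hx⟩)
    · exact measure_ne_top_of_subset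
        (union_subset inter_subset_right inter_subset_right) P.volume_ne_top
  linarith

end

/-- A nonempty proper subset `E ⊊ ℝⁿ` is weakly porous if and only if
`dist(·,E)^{-α}` is an `A₁` weight for some `α > 0`. -/
theorem weaklyPorous_iff_exists_a1 {n : ℕ} (E : Set (EuclideanSpace ℝ (Fin n)))
    (hne : E.Nonempty) (hproper : E ≠ Set.univ) :
    WeaklyPorous E ↔ ∃ α : ℝ, 0 < α ∧ MemA1 (distw E α) := by
  have hn : 0 < n := by
    rcases Nat.eq_zero_or_pos n with rfl | hn
    · exact absurd (Subsingleton.eq_univ_of_nonempty hne) hproper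
    · exact hn
  have hn1 : (1 : ℝ) ≤ √n := Real.one_le_sqrt.2 (by exact_mod_cast hn)
  constructor
  · rintro ⟨c, δ, hc, hc1, hδ, hδ1, h⟩
    refine (h.farWith hn hne hc hc1 hδ hδ1).exists_memA1 (by positivity) ?_ (by positivity) ?_
    · exact (div_le_self hc.le (one_le_pow₀ one_le_two)).trans_lt hc1
    · exact (div_le_self hδ.le (by linarith)).trans hδ1.le
  · rintro ⟨α, hα, h⟩
    obtain ⟨δ, hδ, hδ1, hfar⟩ := h.exists_farWith hα
    refine ⟨1 / 2, (δ / (16 * √n)) ^ n, by norm_num, by norm_num, by positivity, ?_,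
      hfar.weaklyPorousWith hn hne hδ hδ1⟩
    exact pow_lt_one₀ (by positivity) ((div_lt_one (by positivity)).2 (by linarith)) hn.ne'
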